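/- arXiv:2110.15274 — 4 statements merged into one kernel-verified Lean document; each statement's English description precedes it below -/
import Mathlib

section
/- Let n, k be natural numbers with k ≤ n and set m := n − k. Given integer matrices X₂ ∈ ℤ^{m×k}, Z₁ ∈ ℤ^{m×m}, Z₂ ∈ ℤ^{m×k}, form the canonical-form rows r_1,…,r_m ∈ ℤ^{2n} whose x-part is the corresponding row of the block matrix [I_m X₂] and whose z-part is the corresponding row of [Z₁ Z₂]. Define L ∈ ℤ^{m×m} by L_{ij} = ⟨r_i, r_j⟩ when i > j and L_{ij} = 0 otherwise, and let r'_1,…,r'_m be the modified rows whose x-part is unchanged and whose z-part is the corresponding row of [Z₁ + L Z₂]. Then ⟨r'_i, r'_j⟩ = 0 over ℤ for all i, j. Moreover, if q is a positive integer such that q divides ⟨r_i, r_j⟩ for all i, j, then r'_i ≡ r_i (mod q) entrywise for every i. -/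
open Matrix BigOperators

/-- Symplectic product of two vectors in `ℤ^{2n}`, given by their x- and z-parts:
`⟨u, v⟩ = ∑ t, (v_z t * u_x t - v_x t * u_z t)`. -/
def sympProd {ι : Type*} [Fintype ι] (ux uz vx vz : ι → ℤ) : ℤ :=
  ∑ t, (vz t * ux t - vx t * uz t)

theorem sympProd_self {ι : Type*} [Fintype ι] (ux uz : ι → ℤ) : sympProd ux uz ux uz = 0 := by
  simp [sympProd, mul_comm]

theorem sympProd_swap {ι : Type*} [Fintype ι] (ux uz vx vz : ι → ℤ) :
    sympProd vx vz ux uz = -sympProd ux uz vx vz := by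
  simp only [sympProd, ← Finset.sum_neg_distrib]
  exact Finset.sum_congr rfl fun t _ => by ring

/-- Adding `a` and `b` to the z-parts of two vectors adds to their symplectic product
that of the vectors with the same x-parts and z-parts `a` and `b`. -/
theorem sympProd_add_add {ι : Type*} [Fintype ι] (ux uz vx vz a b : ι → ℤ) :
    sympProd ux (uz + a) vx (vz + b) = sympProd ux uz vx vz + sympProd ux a vx b := by
  simp only [sympProd, ← Finset.sum_add_distrib, Pi.add_apply]
  exact Finset.sum_congr rfl fun t _ => by ring

/-- The LDI form construction (Theorem 1 of the paper): starting from canonical-form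
rows `[I_m X₂ | Z₁ Z₂]`, adding the strictly-lower-triangular matrix
`L_{ij} = ⟨r_i, r_j⟩` (for `i > j`) to `Z₁` makes all pairwise symplectic products
vanish over `ℤ`, and if `q ∣ ⟨r_i, r_j⟩` for all `i, j` then the modified rows are
congruent to the original rows entrywise modulo `q`. -/
theorem ldi_canonical_form (n k : ℕ) (hk : k ≤ n)
    (X₂ : Matrix (Fin (n - k)) (Fin k) ℤ)
    (Z₁ : Matrix (Fin (n - k)) (Fin (n - k)) ℤ)
    (Z₂ : Matrix (Fin (n - k)) (Fin k) ℤ)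
    (x z z' : Fin (n - k) → (Fin (n - k) ⊕ Fin k) → ℤ)
    (L : Matrix (Fin (n - k)) (Fin (n - k)) ℤ)
    (hx : ∀ i, x i = Sum.elim (fun j => if i = j then (1 : ℤ) else 0) (X₂ i))
    (hz : ∀ i, z i = Sum.elim (Z₁ i) (Z₂ i))
    (hL : ∀ i j, L i j = if j < i then sympProd (x i) (z i) (x j) (z j) else 0)
    (hz' : ∀ i, z' i = Sum.elim (fun j => Z₁ i j + L i j) (Z₂ i)) :
    (∀ i j, sympProd (x i) (z' i) (x j) (z' j) = 0) ∧
    (∀ q : ℕ, 0 < q →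
      (∀ i j, (q : ℤ) ∣ sympProd (x i) (z i) (x j) (z j)) →
      ∀ i t, (q : ℤ) ∣ (Sum.elim (x i) (z' i) t - Sum.elim (x i) (z i) t)) := by
  have hadd : ∀ i, z' i = z i + Sum.elim (L i) 0 := fun i => by
    ext t
    cases t <;> simp [hz, hz']
  have hcorr : ∀ i j,
      sympProd (x i) (Sum.elim (L i) 0) (x j) (Sum.elim (L j) 0) = L j i - L i j := fun i j => by
    simp [sympProd, hx]
  refine ⟨fun i j => ?_, fun q _ hq i t => ?_⟩
  · rw [hadd, hadd, sympProd_add_add, hcorr, hL, hL]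
    rcases lt_trichotomy i j with h | rfl | h
    · rw [if_pos h, if_neg h.not_gt, sympProd_swap (x i)]
      ring
    · simp [sympProd_self]
    · rw [if_pos h, if_neg h.not_gt]
      ring
  · rcases t with t | t | t
    · simp
    · simp only [hadd, Sum.elim_inr, Pi.add_apply, Sum.elim_inl, add_sub_cancel_left, hL]
      split_ifs
      exacts [hq _ _, dvd_zero _]
    · simp [hadd]
end

section
/- Let q ≥ 2, d ≥ 2 be natural numbers and B ≥ 0 a real number. Let X₁, X₂, Z₁, Z₂ be (d−1)×(d−1) integer matrices with |(X₁)_{ij}| ≤ q−1 and |(X₂)_{ij}| ≤ q−1 for all i, j, with |(Z₁)_{ij}| ≤ B and |(Z₂)_{ij}| ≤ B for all i, j, and with det X₁ ≠ 0. Then every entry of the Schur complement Z₂ − X₂ X₁⁻¹ Z₁ (computed over ℚ, or equivalently ℝ) has absolute value at most B·(1 + (q−1)·C̃·(d−1)²), where C̃ := (q−1)^{d−2}·(d−2)^{(d−2)/2} (interpreted as a real number with real exponent (d−2)/2). -/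
open Matrix Real

/-- **Hadamard's inequality**: the determinant is at most the product of the Euclidean norms of
the rows. -/
theorem Matrix.abs_det_le_prod_norm_row {n : ℕ} (A : Matrix (Fin n) (Fin n) ℝ) :
    |A.det| ≤ ∏ i, ‖WithLp.toLp 2 (A i)‖ := by
  let b := EuclideanSpace.basisFun (Fin n) ℝ
  have : Fact (Module.finrank ℝ (EuclideanSpace ℝ (Fin n)) = n) := ⟨finrank_euclideanSpace_fin⟩
  have hdet : b.toBasis.det (fun i => WithLp.toLp 2 (A i)) = A.det := by
    rw [Module.Basis.det_apply, ← det_transpose A]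
    congr 1
  rw [← hdet, ← Orientation.volumeForm_robust' b.toBasis.orientation b]
  exact Orientation.abs_volumeForm_apply_le _ _

/-- Hadamard's inequality for a matrix whose entries are bounded by `c`. -/
theorem Matrix.abs_det_le_of_abs_entry_le {n : ℕ} {A : Matrix (Fin n) (Fin n) ℝ} {c : ℝ}
    (hc : 0 ≤ c) (hA : ∀ i j, |A i j| ≤ c) : |A.det| ≤ c ^ n * (n : ℝ) ^ ((n : ℝ) / 2) := by
  have hrow (i : Fin n) : ‖WithLp.toLp 2 (A i)‖ ≤ c * √n := by
    rw [EuclideanSpace.norm_eq, ← Real.sqrt_sq hc, ← Real.sqrt_mul (sq_nonneg c)]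
    refine Real.sqrt_le_sqrt ?_
    calc ∑ j, ‖A i j‖ ^ 2 ≤ ∑ _j : Fin n, c ^ 2 :=
          Finset.sum_le_sum fun j _ => pow_le_pow_left₀ (norm_nonneg _) (hA i j) 2
      _ = c ^ 2 * n := by simp [mul_comm]
  calc |A.det| ≤ ∏ i, ‖WithLp.toLp 2 (A i)‖ := A.abs_det_le_prod_norm_row
    _ ≤ ∏ _i : Fin n, c * √n := Finset.prod_le_prod (fun _ _ => norm_nonneg _) fun i _ => hrow i
    _ = c ^ n * (n : ℝ) ^ ((n : ℝ) / 2) := by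
      rw [Finset.prod_const, Finset.card_univ, Fintype.card_fin, mul_pow, Real.sqrt_eq_rpow,
        ← Real.rpow_natCast ((n : ℝ) ^ (1 / 2 : ℝ)), ← Real.rpow_mul n.cast_nonneg,
        one_div_mul_eq_div]

/-- The entries of the inverse of a nonsingular integer matrix are bounded by the largest value
Hadamard's inequality allows for a cofactor. -/
theorem Matrix.abs_inv_map_intCast_le {n : ℕ} {X : Matrix (Fin (n + 1)) (Fin (n + 1)) ℤ} {c : ℝ}
    (hc : 0 ≤ c) (hX : ∀ i j, |(X i j : ℝ)| ≤ c) (hdet : X.det ≠ 0) (i j : Fin (n + 1)) :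
    |(X.map (Int.cast : ℤ → ℝ))⁻¹ i j| ≤ c ^ n * (n : ℝ) ^ ((n : ℝ) / 2) := by
  have hcast : (X.map (Int.cast : ℤ → ℝ)).det = (X.det : ℝ) :=
    (RingHom.map_det (Int.castRingHom ℝ) X).symm
  have hone : (1 : ℝ) ≤ |(X.det : ℝ)| := by
    exact_mod_cast Int.one_le_abs hdet
  rw [inv_def, hcast, Ring.inverse_eq_inv', smul_apply, smul_eq_mul, abs_mul, abs_inv,
    adjugate_fin_succ_eq_det_submatrix, abs_mul, abs_pow, abs_neg, abs_one, one_pow, one_mul]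
  calc _ ≤ 1 * |((X.map (Int.cast : ℤ → ℝ)).submatrix j.succAbove i.succAbove).det| :=
        mul_le_mul_of_nonneg_right (inv_le_one_of_one_le₀ hone) (abs_nonneg _)
    _ ≤ _ := by
      rw [one_mul]
      exact abs_det_le_of_abs_entry_le hc fun _ _ => hX _ _

/-- Multiplying matrices with entries bounded by `a` and `b` gives entries bounded by
`card m * (a * b)`. -/
theorem Matrix.abs_mul_apply_le {l m n : Type*} [Fintype m] {M : Matrix l m ℝ} {N : Matrix m n ℝ}
    {a b : ℝ} (ha : 0 ≤ a) (hM : ∀ i j, |M i j| ≤ a) (hN : ∀ i j, |N i j| ≤ b) (i : l) (j : n) :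
    |(M * N) i j| ≤ Fintype.card m * (a * b) := by
  rw [mul_apply]
  calc |∑ k, M i k * N k j| ≤ ∑ k, |M i k * N k j| := Finset.abs_sum_le_sum_abs _ _
    _ ≤ ∑ _k : m, a * b := Finset.sum_le_sum fun k _ => by
        rw [abs_mul]
        exact mul_le_mul (hM i k) (hN k j) (abs_nonneg _) ha
    _ = Fintype.card m * (a * b) := by simp

/-- Entry bound for the Schur complement `Z₂ - X₂ X₁⁻¹ Z₁`: with `|X₁|, |X₂|`
entrywise at most `q - 1`, `|Z₁|, |Z₂|` entrywise at most `B`, and `det X₁ ≠ 0`,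
each entry is bounded by `B (1 + (q-1) C̃ (d-1)²)` where
`C̃ = (q-1)^{d-2} (d-2)^{(d-2)/2}`. -/
theorem schur_complement_entry_bound (q d : ℕ) (hq : 2 ≤ q) (hd : 2 ≤ d)
    (B : ℝ) (hB : 0 ≤ B)
    (X₁ X₂ Z₁ Z₂ : Matrix (Fin (d - 1)) (Fin (d - 1)) ℤ)
    (hX₁ : ∀ i j, |X₁ i j| ≤ (q : ℤ) - 1)
    (hX₂ : ∀ i j, |X₂ i j| ≤ (q : ℤ) - 1)
    (hZ₁ : ∀ i j, |((Z₁ i j : ℤ) : ℝ)| ≤ B)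
    (hZ₂ : ∀ i j, |((Z₂ i j : ℤ) : ℝ)| ≤ B)
    (hdet : X₁.det ≠ 0) :
    ∀ i j,
      |(Z₂.map (Int.cast : ℤ → ℝ) -
          X₂.map (Int.cast : ℤ → ℝ) * (X₁.map (Int.cast : ℤ → ℝ))⁻¹ *
            Z₁.map (Int.cast : ℤ → ℝ)) i j| ≤
        B * (1 + ((q : ℝ) - 1) *
          (((q : ℝ) - 1) ^ (d - 2) * ((d : ℝ) - 2) ^ (((d : ℝ) - 2) / 2)) *
            ((d : ℝ) - 1) ^ 2) := by
  obtain ⟨n, rfl⟩ : ∃ n, d = n + 2 := ⟨d - 2, by omega⟩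
  have hc : (0 : ℝ) ≤ (q : ℝ) - 1 := by
    have : (2 : ℝ) ≤ q := by exact_mod_cast hq
    linarith
  have h₁ : ∀ i j, |(X₁ i j : ℝ)| ≤ (q : ℝ) - 1 := fun i j => by exact_mod_cast hX₁ i j
  have h₂ : ∀ i j, |(X₂ i j : ℝ)| ≤ (q : ℝ) - 1 := fun i j => by exact_mod_cast hX₂ i j
  have hinv := abs_inv_map_intCast_le hc h₁ hdet
  have hprod := abs_mul_apply_le (by positivity)
    (abs_mul_apply_le (M := X₂.map (Int.cast : ℤ → ℝ)) hc h₂ hinv)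
    (N := Z₁.map (Int.cast : ℤ → ℝ)) hZ₁
  intro i j
  rw [Matrix.sub_apply]
  refine (abs_sub _ _).trans ((add_le_add (hZ₂ i j) (hprod i j)).trans_eq ?_)
  have e₁ : ((n + 2 : ℕ) : ℝ) - 2 = n := by push_cast; ring
  have e₂ : ((n + 2 : ℕ) : ℝ) - 1 = n + 1 := by push_cast; ring
  rw [e₁, e₂]
  simp only [Fintype.card_fin, Nat.add_sub_cancel]
  push_cast
  ring
end

section
/- Let q ≥ 2, d ≥ 2 be natural numbers and B ≥ 0 a real number. Let X₁, X₂, Z₁, Z₂ be (d−1)×(d−1) integer matrices with |(X₁)_{ij}| ≤ q−1 and |(X₂)_{ij}| ≤ q−1 for all i, j, with |(Z₁)_{ij}| ≤ B and |(Z₂)_{ij}| ≤ B for all i, j, and with det X₁ ≠ 0. Let M be the 2(d−1)×2(d−1) block matrix [[X₁, Z₁],[X₂, Z₂]]. Then |det M| ≤ (B(q−1)(d−1)(1 + (d−1)²(q−1)^{d−1}(d−2)^{(d−2)/2}))^{d−1}, where the right-hand side is interpreted as a real number with real exponent (d−2)/2. -/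
open Matrix Real

/-- **Hadamard's inequality** for real matrices indexed by `Fin m`, in terms of the rows. -/
theorem abs_det_le_prod_norm_row_fin {m : ℕ} (A : Matrix (Fin m) (Fin m) ℝ) :
    |A.det| ≤ ∏ i, ‖WithLp.toLp 2 (A i)‖ := by
  let b := EuclideanSpace.basisFun (Fin m) ℝ
  have : Fact (Module.finrank ℝ (EuclideanSpace ℝ (Fin m)) = m) := ⟨by simp⟩
  have h := b.toBasis.orientation.abs_volumeForm_apply_le fun i => WithLp.toLp 2 (A i)
  rw [b.toBasis.orientation.volumeForm_robust b rfl, Module.Basis.det_apply] at h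
  convert h using 2
  rw [← det_transpose]
  congr 1

/-- **Hadamard's inequality** for real matrices, in terms of the columns. -/
theorem abs_det_le_prod_norm_col {ι : Type*} [Fintype ι] [DecidableEq ι] (A : Matrix ι ι ℝ) :
    |A.det| ≤ ∏ j, ‖WithLp.toLp 2 (A.col j)‖ := by
  let e := Fintype.equivFin ι
  have h := abs_det_le_prod_norm_row_fin (Matrix.reindex e e Aᵀ)
  rw [det_reindex_self, det_transpose] at h
  refine h.trans_eq ?_
  rw [← e.symm.prod_comp]
  refine Finset.prod_congr rfl fun i _ => ?_
  rw [EuclideanSpace.norm_eq, EuclideanSpace.norm_eq, ← e.symm.sum_comp]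
  rfl

/-- A vector with entries bounded by `c` has Euclidean norm at most `√(card ι) * c`. -/
theorem norm_toLp_le_sqrt_card_mul {ι : Type*} [Fintype ι] {v : ι → ℝ} {c : ℝ} (hc : 0 ≤ c)
    (hv : ∀ i, |v i| ≤ c) : ‖WithLp.toLp 2 v‖ ≤ √(Fintype.card ι) * c := by
  rw [EuclideanSpace.norm_eq]
  refine Real.sqrt_le_iff.2 ⟨by positivity, ?_⟩
  rw [mul_pow, Real.sq_sqrt (Nat.cast_nonneg _)]
  calc ∑ i, ‖v i‖ ^ 2 ≤ ∑ _i : ι, c ^ 2 :=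
        Finset.sum_le_sum fun i _ => pow_le_pow_left₀ (norm_nonneg _) (hv i) 2
    _ = Fintype.card ι * c ^ 2 := by simp

/-- A `2n × 2n` matrix whose first `n` columns have entries bounded by `a` and whose last `n`
columns have entries bounded by `b` has determinant at most `(2 n a b) ^ n`. -/
theorem abs_det_fromBlocks_le {n : ℕ} {X₁ X₂ Z₁ Z₂ : Matrix (Fin n) (Fin n) ℝ} {a b : ℝ}
    (ha : 0 ≤ a) (hb : 0 ≤ b) (hX₁ : ∀ i j, |X₁ i j| ≤ a) (hX₂ : ∀ i j, |X₂ i j| ≤ a)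
    (hZ₁ : ∀ i j, |Z₁ i j| ≤ b) (hZ₂ : ∀ i j, |Z₂ i j| ≤ b) :
    |(fromBlocks X₁ Z₁ X₂ Z₂).det| ≤ (2 * n * a * b) ^ n := by
  refine (abs_det_le_prod_norm_col _).trans ?_
  have hX (j : Fin n) : ‖WithLp.toLp 2 ((fromBlocks X₁ Z₁ X₂ Z₂).col (Sum.inl j))‖ ≤
      √(Fintype.card (Fin n ⊕ Fin n)) * a :=
    norm_toLp_le_sqrt_card_mul ha (Sum.rec (hX₁ · j) (hX₂ · j))
  have hZ (j : Fin n) : ‖WithLp.toLp 2 ((fromBlocks X₁ Z₁ X₂ Z₂).col (Sum.inr j))‖ ≤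
      √(Fintype.card (Fin n ⊕ Fin n)) * b :=
    norm_toLp_le_sqrt_card_mul hb (Sum.rec (hZ₁ · j) (hZ₂ · j))
  have hcard : √(Fintype.card (Fin n ⊕ Fin n)) ^ 2 = 2 * n := by
    rw [Real.sq_sqrt (Nat.cast_nonneg _)]
    simp [two_mul]
  rw [Fintype.prod_sum_type]
  calc _ ≤ (∏ _j : Fin n, √(Fintype.card (Fin n ⊕ Fin n)) * a) *
        ∏ _j : Fin n, √(Fintype.card (Fin n ⊕ Fin n)) * b := by
        gcongr with j _ j _
        · exact hX j
        · exact hZ j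
    _ = (√(Fintype.card (Fin n ⊕ Fin n)) ^ 2 * a * b) ^ n := by
        rw [Finset.prod_const, Finset.prod_const, Finset.card_univ, Fintype.card_fin, ← mul_pow]
        ring
    _ = (2 * n * a * b) ^ n := by rw [hcard]

theorem one_le_natCast_rpow_half (k : ℕ) : 1 ≤ (k : ℝ) ^ ((k : ℝ) / 2) := by
  rcases Nat.eq_zero_or_pos k with rfl | hk
  · simp
  · exact Real.one_le_rpow (by exact_mod_cast hk) (by positivity)

/-- Determinant bound at the heart of Theorem 3 of the paper: the
`2(d-1) × 2(d-1)` block matrix `[[X₁, Z₁], [X₂, Z₂]]` with `|X₁|, |X₂|` entrywise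
at most `q - 1`, `|Z₁|, |Z₂|` entrywise at most `B`, and `det X₁ ≠ 0`, has
`|det M| ≤ (B (q-1)(d-1)(1 + (d-1)² (q-1)^{d-1} (d-2)^{(d-2)/2}))^{d-1}`. -/
theorem block_det_bound (q d : ℕ) (hq : 2 ≤ q) (hd : 2 ≤ d)
    (B : ℝ) (hB : 0 ≤ B)
    (X₁ X₂ Z₁ Z₂ : Matrix (Fin (d - 1)) (Fin (d - 1)) ℤ)
    (hX₁ : ∀ i j, |X₁ i j| ≤ (q : ℤ) - 1)
    (hX₂ : ∀ i j, |X₂ i j| ≤ (q : ℤ) - 1)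
    (hZ₁ : ∀ i j, |((Z₁ i j : ℤ) : ℝ)| ≤ B)
    (hZ₂ : ∀ i j, |((Z₂ i j : ℤ) : ℝ)| ≤ B)
    (hdet : X₁.det ≠ 0) :
    |(((Matrix.fromBlocks X₁ Z₁ X₂ Z₂).det : ℤ) : ℝ)| ≤
      (B * ((q : ℝ) - 1) * ((d : ℝ) - 1) *
        (1 + ((d : ℝ) - 1) ^ 2 * ((q : ℝ) - 1) ^ (d - 1) *
          ((d : ℝ) - 2) ^ (((d : ℝ) - 2) / 2))) ^ (d - 1) := by
  obtain ⟨k, rfl⟩ := Nat.exists_eq_add_of_le' hd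
  have hk : k + 2 - 1 = k + 1 := rfl
  have hq' : (1 : ℝ) ≤ (q : ℝ) - 1 := by
    have : (2 : ℝ) ≤ q := by exact_mod_cast hq
    linarith
  have hcast {x : ℤ} (hx : |x| ≤ (q : ℤ) - 1) : |(x : ℝ)| ≤ (q : ℝ) - 1 := by
    exact_mod_cast hx
  have h := abs_det_fromBlocks_le (X₁ := X₁.map (Int.cast : ℤ → ℝ)) (X₂ := X₂.map Int.cast)
    (Z₁ := Z₁.map Int.cast) (Z₂ := Z₂.map Int.cast) (zero_le_one.trans hq') hB
    (fun i j => hcast (hX₁ i j)) (fun i j => hcast (hX₂ i j)) hZ₁ hZ₂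
  rw [← fromBlocks_map, ← Int.cast_det] at h
  refine h.trans (pow_le_pow_left₀ (by positivity) ?_ _)
  have hd1 : ((k + 2 : ℕ) : ℝ) - 1 = k + 1 := by push_cast; ring
  have hd2 : ((k + 2 : ℕ) : ℝ) - 2 = k := by push_cast; ring
  rw [hk, hd1, hd2]
  have h1 : (1 : ℝ) ≤ ((k : ℝ) + 1) ^ 2 * ((q : ℝ) - 1) ^ (k + 1) * (k : ℝ) ^ ((k : ℝ) / 2) :=
    one_le_mul_of_one_le_of_one_le
      (one_le_mul_of_one_le_of_one_le (one_le_pow₀ (by simp)) (one_le_pow₀ hq'))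
      (one_le_natCast_rpow_half k)
  calc 2 * ((k + 1 : ℕ) : ℝ) * ((q : ℝ) - 1) * B
      = B * ((q : ℝ) - 1) * (k + 1) * (1 + 1) := by push_cast; ring
    _ ≤ _ := by gcongr
end

section
/- Let q ≥ 2, d ≥ 2 be natural numbers and B ≥ 0 a real number, and set s := 2(d−1). Let X₁, X₂, Z₁, Z₂ be s×s integer matrices with |(X₁)_{ij}| ≤ q−1 and |(X₂)_{ij}| ≤ q−1, with |(Z₁)_{ij}| ≤ B and |(Z₂)_{ij}| ≤ B, and with det X₁ ≠ 0. Let M be the 2s×2s block matrix [[X₁, Z₁],[X₂, Z₂]], assume additionally that every entry of M has absolute value at most B, and that det M ≠ 0 over ℤ. Then for every prime p with (p : ℝ) > min{ B^{4(d−1)}·(4(d−1))^{2(d−1)}, ((q−1)·2(d−1)·B·(1 + (q−1)·C̃·(2(d−1))²))^{2(d−1)} }, where C̃ := ((q−1)²(2d−3))^{(2d−3)/2} (real exponent), the reduction of M modulo p has nonzero determinant over ZMod p, i.e. M mod p is invertible and has trivial kernel. -/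
open Matrix Real

namespace Matrix

/-- **Hadamard's determinant inequality** for a real matrix with uniformly bounded entries. -/
theorem abs_det_le_sqrt_card_mul_pow {n : Type*} [Fintype n] [DecidableEq n]
    (A : Matrix n n ℝ) {c : ℝ} (hc : 0 ≤ c) (hA : ∀ i j, |A i j| ≤ c) :
    |A.det| ≤ (√(Fintype.card n) * c) ^ Fintype.card n := by
  rcases isEmpty_or_nonempty n with hn | hn
  · simp
  have hpos : (0 : ℝ) < Fintype.card n := by exact_mod_cast Fintype.card_pos
  have hG := posSemidef_conjTranspose_mul_self A
  have hnonneg := hG.eigenvalues_nonneg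
  have hdet : A.det ^ 2 = ∏ i, hG.isHermitian.eigenvalues i := by
    have h := hG.isHermitian.det_eq_prod_eigenvalues
    simp only [det_mul, det_conjTranspose, star_trivial, RCLike.ofReal_real_eq_id, id] at h
    rw [← h, sq]
  have htrace : ∑ i, hG.isHermitian.eigenvalues i ≤ Fintype.card n * (Fintype.card n * c ^ 2) := by
    have h := hG.isHermitian.trace_eq_sum_eigenvalues
    simp only [RCLike.ofReal_real_eq_id, id] at h
    rw [← h]
    simp only [trace, diag, mul_apply, conjTranspose_apply, star_trivial]
    calc ∑ i, ∑ j, A j i * A j i ≤ ∑ _i : n, ∑ _j : n, c ^ 2 := by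
          gcongr with i _ j _
          rw [← sq]
          exact sq_le_sq.2 (by rw [abs_of_nonneg hc]; exact hA j i)
      _ = _ := by simp
  have hamgm := Real.geom_mean_le_arith_mean Finset.univ (fun _ : n => (1 : ℝ))
    hG.isHermitian.eigenvalues (by simp) (by simpa using hpos) (fun i _ => hnonneg i)
  simp only [Real.rpow_one, one_mul, Finset.sum_const, Finset.card_univ, nsmul_eq_mul, mul_one,
    ← hdet] at hamgm
  have hbound : A.det ^ 2 ≤ (Fintype.card n * c ^ 2) ^ Fintype.card n := by
    calc A.det ^ 2 = ((A.det ^ 2) ^ ((Fintype.card n : ℝ)⁻¹)) ^ Fintype.card n :=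
          (Real.rpow_inv_natCast_pow (sq_nonneg _) Fintype.card_ne_zero).symm
      _ ≤ _ := by
          gcongr
          exact hamgm.trans ((div_le_iff₀' hpos).2 htrace)
  refine abs_le_of_sq_le_sq (hbound.trans_eq ?_) (by positivity)
  rw [← pow_mul, mul_comm _ 2, pow_mul, mul_pow (√_), Real.sq_sqrt hpos.le]

theorem abs_adjugate_le {s : ℕ} (A : Matrix (Fin s) (Fin s) ℝ) {c : ℝ} (hc : 0 ≤ c)
    (hA : ∀ i j, |A i j| ≤ c) (i j : Fin s) :
    |A.adjugate i j| ≤ (√((s - 1 : ℕ) : ℝ) * c) ^ (s - 1) := by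
  cases s with
  | zero => exact i.elim0
  | succ n =>
    rw [adjugate_fin_succ_eq_det_submatrix, abs_mul, abs_pow, abs_neg, abs_one, one_pow, one_mul]
    simpa using abs_det_le_sqrt_card_mul_pow (A.submatrix j.succAbove i.succAbove) hc
      (fun _ _ => hA _ _)

theorem abs_mul_apply_le_s13 {l m n : Type*} [Fintype m] (A : Matrix l m ℝ) (B : Matrix m n ℝ)
    {a b : ℝ} (ha : 0 ≤ a) (hA : ∀ i j, |A i j| ≤ a) (hB : ∀ i j, |B i j| ≤ b) (i : l) (j : n) :
    |(A * B) i j| ≤ Fintype.card m * (a * b) := by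
  rw [mul_apply]
  calc |∑ k, A i k * B k j| ≤ ∑ k, |A i k * B k j| := Finset.abs_sum_le_sum_abs _ _
    _ ≤ ∑ _k : m, a * b := by
        gcongr with k _
        rw [abs_mul]
        exact mul_le_mul (hA i k) (hB k j) (abs_nonneg _) ha
    _ = _ := by simp

/-- A determinant bound for a block matrix with entries of the first block column bounded by `c`
and of the second by `b`, obtained from the Schur complement. -/
theorem abs_det_fromBlocks_le {s : ℕ} (X₁ Z₁ X₂ Z₂ : Matrix (Fin s) (Fin s) ℝ) {b c : ℝ}
    (hb : 0 ≤ b) (hc : 0 ≤ c) (hX₁ : ∀ i j, |X₁ i j| ≤ c) (hX₂ : ∀ i j, |X₂ i j| ≤ c)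
    (hZ₁ : ∀ i j, |Z₁ i j| ≤ b) (hZ₂ : ∀ i j, |Z₂ i j| ≤ b) (hdet : 1 ≤ |X₁.det|) :
    |(fromBlocks X₁ Z₁ X₂ Z₂).det| ≤
      (c * s * b * (1 + c * (√((s - 1 : ℕ) : ℝ) * c) ^ (s - 1) * s ^ 2)) ^ s := by
  set K : ℝ := (√((s - 1 : ℕ) : ℝ) * c) ^ (s - 1)
  have hK : 0 ≤ K := by positivity
  have hunit : IsUnit X₁.det := isUnit_iff_ne_zero.2 fun h => by norm_num [h] at hdet
  have := X₁.invertibleOfIsUnitDet hunit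
  have hinv : ∀ i j, |(⅟X₁) i j| ≤ K := fun i j => by
    rw [invOf_eq_nonsing_inv, inv_def, Ring.inverse_eq_inv', smul_apply, smul_eq_mul, abs_mul,
      abs_inv]
    exact (mul_le_of_le_one_left (abs_nonneg _) (inv_le_one_of_one_le₀ hdet)).trans
      (abs_adjugate_le X₁ hc hX₁ i j)
  have hschur : ∀ i j, |(Z₂ - X₂ * ⅟X₁ * Z₁) i j| ≤ b * (1 + c * K * s ^ 2) := fun i j => by
    have h₁ := abs_mul_apply_le_s13 X₂ (⅟X₁) hc hX₂ hinv
    have h₂ := abs_mul_apply_le_s13 (X₂ * ⅟X₁) Z₁ (by positivity) h₁ hZ₁ i j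
    rw [Fintype.card_fin] at h₂
    calc |(Z₂ - X₂ * ⅟X₁ * Z₁) i j| ≤ |Z₂ i j| + |(X₂ * ⅟X₁ * Z₁) i j| := abs_sub _ _
      _ ≤ b + s * (s * (c * K) * b) := add_le_add (hZ₂ i j) h₂
      _ = _ := by ring
  have hX := abs_det_le_sqrt_card_mul_pow X₁ hc hX₁
  have hS := abs_det_le_sqrt_card_mul_pow _ (by positivity) hschur
  rw [Fintype.card_fin] at hX hS
  rw [det_fromBlocks₁₁, abs_mul]
  refine (mul_le_mul hX hS (abs_nonneg _) (by positivity)).trans_eq ?_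
  rw [← mul_pow]
  congr 1
  linear_combination c * b * (1 + c * K * s ^ 2) * Real.mul_self_sqrt (Nat.cast_nonneg (α := ℝ) s)

/-- An integer matrix whose determinant is nonzero and smaller than a prime `p` in absolute value
has nonzero determinant modulo `p`. -/
theorem det_map_zmod_ne_zero {n : Type*} [Fintype n] [DecidableEq n] (M : Matrix n n ℤ)
    (hM : M.det ≠ 0) {p : ℕ} (hp : |M.det| < p) :
    (M.map (Int.cast : ℤ → ZMod p)).det ≠ 0 := by
  have hcast : ((M.det : ℤ) : ZMod p) = (M.map (Int.cast : ℤ → ZMod p)).det :=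
    (Int.castRingHom (ZMod p)).map_det M
  rw [← hcast, Ne, ZMod.intCast_zmod_eq_zero_iff_dvd]
  exact fun h => hM (Int.eq_zero_of_abs_lt_dvd h hp)

theorem cast_det_real {n : Type*} [Fintype n] [DecidableEq n] (M : Matrix n n ℤ) :
    ((M.det : ℤ) : ℝ) = (M.map (Int.cast : ℤ → ℝ)).det :=
  (Int.castRingHom ℝ).map_det M

end Matrix

/-- Linear-algebraic core of Theorem 4 of the paper (distance promise for
degenerate codes): a `4(d-1) × 4(d-1)` block minor `M = [[X₁, Z₁], [X₂, Z₂]]`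
(blocks of size `2(d-1)`, entries of `X₁, X₂` bounded by `q - 1`, entries of
`Z₁, Z₂` and of `M` bounded by `B`, `det X₁ ≠ 0`) with nonzero integer
determinant stays nonsingular modulo any prime `p` exceeding the cutoff
`p_D* = min{B^{4(d-1)} (4(d-1))^{2(d-1)},
((q-1)·2(d-1)·B·(1 + (q-1) C̃ (2(d-1))²))^{2(d-1)}}` with
`C̃ = ((q-1)² (2d-3))^{(2d-3)/2}`. -/
theorem degenerate_no_artifact_error_above_cutoff (q d : ℕ) (hq : 2 ≤ q) (hd : 2 ≤ d)
    (B : ℝ) (hB : 0 ≤ B)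
    (X₁ X₂ Z₁ Z₂ : Matrix (Fin (2 * (d - 1))) (Fin (2 * (d - 1))) ℤ)
    (hX₁ : ∀ i j, |X₁ i j| ≤ (q : ℤ) - 1)
    (hX₂ : ∀ i j, |X₂ i j| ≤ (q : ℤ) - 1)
    (hZ₁ : ∀ i j, |((Z₁ i j : ℤ) : ℝ)| ≤ B)
    (hZ₂ : ∀ i j, |((Z₂ i j : ℤ) : ℝ)| ≤ B)
    (hdetX₁ : X₁.det ≠ 0)
    (hMent : ∀ i j, |(((Matrix.fromBlocks X₁ Z₁ X₂ Z₂) i j : ℤ) : ℝ)| ≤ B)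
    (hdetM : (Matrix.fromBlocks X₁ Z₁ X₂ Z₂).det ≠ 0)
    (p : ℕ) (hp : p.Prime)
    (hpgt : (p : ℝ) >
      min (B ^ (4 * (d - 1)) * (4 * ((d : ℝ) - 1)) ^ (2 * (d - 1)))
        ((((q : ℝ) - 1) * (2 * ((d : ℝ) - 1)) * B *
          (1 + ((q : ℝ) - 1) *
            ((((q : ℝ) - 1) ^ 2 * (2 * (d : ℝ) - 3)) ^ ((2 * (d : ℝ) - 3) / 2)) *
              (2 * ((d : ℝ) - 1)) ^ 2)) ^ (2 * (d - 1)))) :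
    ((Matrix.fromBlocks X₁ Z₁ X₂ Z₂).map (Int.cast : ℤ → ZMod p)).det ≠ 0 ∧
    IsUnit ((Matrix.fromBlocks X₁ Z₁ X₂ Z₂).map (Int.cast : ℤ → ZMod p)) ∧
    ∀ v : (Fin (2 * (d - 1)) ⊕ Fin (2 * (d - 1))) → ZMod p,
      ((Matrix.fromBlocks X₁ Z₁ X₂ Z₂).map (Int.cast : ℤ → ZMod p)).mulVec v = 0 →
        v = 0 := by
  have hp' : Fact p.Prime := ⟨hp⟩
  set M := Matrix.fromBlocks X₁ Z₁ X₂ Z₂ with hMdef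
  have hq₁ : (0 : ℝ) ≤ (q : ℝ) - 1 := sub_nonneg.2 (by exact_mod_cast (by omega : 1 ≤ q))
  have hs : ((2 * (d - 1) : ℕ) : ℝ) = 2 * ((d : ℝ) - 1) := by
    push_cast [Nat.cast_sub (by omega : 1 ≤ d)]; ring
  have hs' : ((2 * (d - 1) - 1 : ℕ) : ℝ) = 2 * (d : ℝ) - 3 := by
    rw [Nat.cast_sub (by omega), hs]; push_cast; ring
  have hcast : ∀ Y : Matrix (Fin (2 * (d - 1))) (Fin (2 * (d - 1))) ℤ,
      (∀ i j, |Y i j| ≤ (q : ℤ) - 1) →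
        ∀ i j, |Y.map (Int.cast : ℤ → ℝ) i j| ≤ (q : ℝ) - 1 := fun Y hY i j => by
    simpa using (Int.cast_le (R := ℝ)).2 (hY i j)
  have hbound₁ : |(M.det : ℝ)| ≤ B ^ (4 * (d - 1)) * (4 * ((d : ℝ) - 1)) ^ (2 * (d - 1)) := by
    rw [Matrix.cast_det_real]
    have hcard : 2 * (d - 1) + 2 * (d - 1) = 2 * (2 * (d - 1)) := by ring
    refine (Matrix.abs_det_le_sqrt_card_mul_pow _ hB hMent).trans_eq ?_
    rw [Fintype.card_sum, Fintype.card_fin, hcard, mul_pow, pow_mul, Real.sq_sqrt (by positivity),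
      mul_comm, Nat.cast_mul, hs, show 4 * (d - 1) = 2 * (2 * (d - 1)) by ring]
    congr 2
    push_cast; ring
  have hbound₂ := Matrix.abs_det_fromBlocks_le _ (Z₁.map (Int.cast : ℤ → ℝ)) _
    (Z₂.map (Int.cast : ℤ → ℝ)) hB hq₁ (hcast X₁ hX₁) (hcast X₂ hX₂) hZ₁ hZ₂
    (by
      rw [← Matrix.cast_det_real]
      exact_mod_cast Int.one_le_abs hdetX₁)
  have hC : (((q : ℝ) - 1) ^ 2 * (2 * (d : ℝ) - 3)) ^ ((2 * (d : ℝ) - 3) / 2) =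
      (√((2 * (d - 1) - 1 : ℕ) : ℝ) * ((q : ℝ) - 1)) ^ (2 * (d - 1) - 1) := by
    rw [← hs', Real.rpow_div_two_eq_sqrt _ (by positivity), Real.rpow_natCast,
      Real.sqrt_mul (sq_nonneg _), Real.sqrt_sq hq₁, mul_comm]
  rw [← Matrix.fromBlocks_map, ← hMdef, ← Matrix.cast_det_real, ← hC, hs] at hbound₂
  have hlt : |M.det| < (p : ℤ) := by
    have h : |(M.det : ℝ)| < p := (le_min hbound₁ hbound₂).trans_lt hpgt
    exact_mod_cast h
  have hdet := Matrix.det_map_zmod_ne_zero M hdetM hlt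
  exact ⟨hdet, (Matrix.isUnit_iff_isUnit_det _).2 hdet.isUnit,
    fun v hv => Matrix.eq_zero_of_mulVec_eq_zero hdet hv⟩
end
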